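/- For each fixed δ ∈ (0,2) there exist a constant C₂ > 0 and N ∈ ℕ such that for all n ≥ N and all integers k, m with δn ≤ k ≤ m ≤ 2n, one has |Var(𝔇_m·(m/n)^α − 𝔇_k·(k/n)^α) − n·∫_{k/n}^{m/n} u^{2α} du| ≤ C₂·√n·(log n)². -/

import Mathlib

open MeasureTheory ProbabilityTheory Filter

/-- The asymptotic condition `1/w(n) = n^α (1 + 2B/n + O(1/n²))` on the weight function. -/
def WeightAsymp (w : ℕ → ℝ) (α B : ℝ) : Prop :=
  ∃ C₀ > (0:ℝ), ∃ N₀ : ℕ, ∀ n : ℕ, N₀ ≤ n →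
    |1 / w n - (n:ℝ) ^ α - 2 * B * (n:ℝ) ^ (α - 1)| ≤ C₀ * (n:ℝ) ^ (α - 2)

/-- The three admissible choices of `(b, r)` in terms of the weight function `w`. -/
def UrnChoice (w b r : ℕ → ℝ) : Prop :=
  (∀ i, b i = w (2*i) ∧ r i = w (2*i+1)) ∨
  (∀ i, b i = w (2*i+1) ∧ r i = w (2*i)) ∨
  (∀ i, b i = w (2*i) ∧ r i = w (2*i))

/-- A generalized Pólya urn process: `Bl n` and `Re n` are the numbers of blue and red
balls drawn in the first `n` draws; started at `(0,0)`, exactly one coordinate increases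
by `1` at each step, and conditionally on the past the blue coordinate increases with
probability `b(Bl n)/(b(Bl n) + r(Re n))`. -/
structure Urn {Ω : Type*} [MeasurableSpace Ω] (μ : Measure Ω) (b r : ℕ → ℝ) where
  Bl : ℕ → Ω → ℕ
  Re : ℕ → Ω → ℕ
  meas_Bl : ∀ n, Measurable (Bl n)
  meas_Re : ∀ n, Measurable (Re n)
  init_Bl : ∀ ω, Bl 0 ω = 0
  init_Re : ∀ ω, Re 0 ω = 0
  step : ∀ n ω, (Bl (n+1) ω = Bl n ω + 1 ∧ Re (n+1) ω = Re n ω) ∨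
                (Bl (n+1) ω = Bl n ω ∧ Re (n+1) ω = Re n ω + 1)
  markov : ∀ n : ℕ,
    μ[(fun ω => if Bl (n+1) ω = Bl n ω + 1 then (1:ℝ) else 0) |
        ⨆ j ∈ Set.Iic n, MeasurableSpace.comap (fun ω => (Bl j ω, Re j ω)) inferInstance]
      =ᵐ[μ] fun ω => b (Bl n ω) / (b (Bl n ω) + r (Re n ω))

namespace Urn

variable {Ω : Type*} [MeasurableSpace Ω] {μ : Measure Ω} {b r : ℕ → ℝ}

/-- The discrepancy `𝔇_n = ℜ_n − 𝔅_n`. -/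
def D (U : Urn μ b r) (n : ℕ) (ω : Ω) : ℤ := (U.Re n ω : ℤ) - (U.Bl n ω : ℤ)

/-- `τ_k^𝔅`, the number of draws until the `k`-th blue ball. -/
noncomputable def tau (U : Urn μ b r) : ℕ → Ω → ℕ
  | 0 => fun _ => 0
  | k+1 => fun ω => sInf {n : ℕ | U.tau k ω < n ∧ U.Bl n ω = U.Bl (n-1) ω + 1}

/-- The natural filtration `ℱ_n = σ((𝔅_j, ℜ_j), j ≤ n)`. -/
def F (U : Urn μ b r) (n : ℕ) : MeasurableSpace Ω :=
  ⨆ j ∈ Set.Iic n, MeasurableSpace.comap (fun ω => (U.Bl j ω, U.Re j ω)) inferInstance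

end Urn

lemma exists_rpow_one_add_le (β : ℝ) :
    ∃ C > 0, ∀ x : ℝ, |x| ≤ 1 / 2 → (1 + x) ^ β ≤ C := by
  have hc : ContinuousOn (fun x : ℝ => (1 + x) ^ β) (Set.Icc (-(1 / 2)) (1 / 2)) := by
    intro x hx
    have : (1 + x) ≠ 0 := by linarith [hx.1]
    exact (ContinuousAt.rpow_const (by fun_prop) (Or.inl this)).continuousWithinAt
  obtain ⟨C, hC⟩ := isCompact_Icc.exists_bound_of_continuousOn hc
  refine ⟨max C 1, by positivity, fun x hx => ?_⟩
  exact (le_abs_self _).trans ((hC x (abs_le.1 hx)).trans (le_max_left _ _))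

lemma hasDerivAt_rpow_one_add (β : ℝ) {x : ℝ} (hx : |x| ≤ 1 / 2) :
    HasDerivAt (fun x : ℝ => (1 + x) ^ β) (β * (1 + x) ^ (β - 1)) x := by
  have h : 1 + x ≠ 0 := by linarith [(abs_le.1 hx).1]
  simpa using ((hasDerivAt_id x).const_add 1).rpow_const (p := β) (Or.inl h)

lemma exists_abs_rpow_one_add_sub_one_le (β : ℝ) :
    ∃ C > 0, ∀ x : ℝ, |x| ≤ 1 / 2 → |(1 + x) ^ β - 1| ≤ C * |x| := by
  obtain ⟨C, hC, h⟩ := exists_rpow_one_add_le (β - 1)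
  refine ⟨(|β| + 1) * C, by positivity, fun x hx => ?_⟩
  have key := (convex_closedBall (0 : ℝ) (1 / 2)).norm_image_sub_le_of_norm_hasDerivWithin_le
    (f := fun x : ℝ => (1 + x) ^ β) (f' := fun x => β * (1 + x) ^ (β - 1)) (C := (|β| + 1) * C)
    (x := 0) (y := x)
    (fun y hy => (hasDerivAt_rpow_one_add β (by simpa using hy)).hasDerivWithinAt)
    (fun y hy => by
      have hy : |y| ≤ 1 / 2 := by simpa using hy
      have h0 : 0 ≤ (1 + y) ^ (β - 1) := Real.rpow_nonneg (by linarith [(abs_le.1 hy).1]) _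
      rw [Real.norm_eq_abs, abs_mul, abs_of_nonneg h0]
      exact mul_le_mul (by linarith) (h y hy) h0 (by positivity))
    (by simp) (by simpa using hx)
  simpa using key

lemma exists_abs_rpow_one_add_sub_linear_le (β : ℝ) :
    ∃ C > 0, ∀ x : ℝ, |x| ≤ 1 / 2 → |(1 + x) ^ β - 1 - β * x| ≤ C * x ^ 2 := by
  obtain ⟨C, hC, h⟩ := exists_abs_rpow_one_add_sub_one_le (β - 1)
  refine ⟨(|β| + 1) * C, by positivity, fun x hx => ?_⟩
  have key := (convex_closedBall (0 : ℝ) |x|).norm_image_sub_le_of_norm_hasDerivWithin_le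
    (f := fun x : ℝ => (1 + x) ^ β - β * x) (f' := fun x => β * (1 + x) ^ (β - 1) - β)
    (C := (|β| + 1) * C * |x|) (x := 0) (y := x)
    (fun y hy => by
      have hy : |y| ≤ |x| := by simpa using hy
      have h := ((hasDerivAt_id y).const_mul β)
      rw [mul_one] at h
      exact ((hasDerivAt_rpow_one_add β (hy.trans hx)).sub h).hasDerivWithinAt)
    (fun y hy => by
      have hy : |y| ≤ |x| := by simpa using hy
      have e : β * (1 + y) ^ (β - 1) - β = β * ((1 + y) ^ (β - 1) - 1) := by ring
      rw [Real.norm_eq_abs, e, abs_mul, mul_assoc]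
      exact mul_le_mul (by linarith) ((h y (hy.trans hx)).trans (by gcongr)) (abs_nonneg _)
        (by positivity))
    (by simp) (by simp)
  have e : (1 + x) ^ β - 1 - β * x = (1 + x) ^ β - β * x - 1 := by ring
  rw [e, ← sq_abs x]
  simpa [pow_two, mul_assoc] using key

/-- `p` grows like `(i + 1) ^ α`, with relative error `O(1 / i)`. -/
def RegularGrowth (α K c : ℝ) (p : ℕ → ℝ) : Prop :=
  ∀ i : ℕ, |p i - ((i : ℝ) + 1) ^ α| ≤ K * ((i : ℝ) + 1) ^ (α - 1) ∧ c * ((i : ℝ) + 1) ^ α ≤ p i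

lemma exists_abs_div_rpow_sub_le (α : ℝ) {K : ℝ} (hK : 0 < K) :
    ∃ C > 0, ∀ M p x : ℝ, 0 < M → |x| ≤ 1 / 2 →
      |p - (M * (1 + x)) ^ α| ≤ K * (M * (1 + x)) ^ (α - 1) →
      |p / M ^ α - 1 - α * x| ≤ C * (x ^ 2 + 1 / M) := by
  obtain ⟨C₁, hC₁, h₁⟩ := exists_abs_rpow_one_add_sub_linear_le α
  obtain ⟨C₂, hC₂, h₂⟩ := exists_rpow_one_add_le (α - 1)
  refine ⟨C₁ + K * C₂, by positivity, fun M p x hM hx hp => ?_⟩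
  have hx1 : 0 ≤ 1 + x := by linarith [(abs_le.1 hx).1]
  have hMa : 0 < M ^ α := by positivity
  rw [Real.mul_rpow hM.le hx1, Real.mul_rpow hM.le hx1, Real.rpow_sub_one hM.ne'] at hp
  have e : p / M ^ α - (1 + x) ^ α = (p - M ^ α * (1 + x) ^ α) / M ^ α := by
    field_simp
  have hp' : |p / M ^ α - (1 + x) ^ α| ≤ K * C₂ * (1 / M) := by
    rw [e, abs_div, abs_of_pos hMa, div_le_iff₀ hMa]
    calc _ ≤ _ := hp
      _ = K * (1 + x) ^ (α - 1) * (1 / M) * M ^ α := by ring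
      _ ≤ _ := by gcongr; exact h₂ x hx
  have := h₁ x hx
  have hM' : 0 < 1 / M := by positivity
  calc |p / M ^ α - 1 - α * x|
      = |(p / M ^ α - (1 + x) ^ α) + ((1 + x) ^ α - 1 - α * x)| := by ring_nf
    _ ≤ K * C₂ * (1 / M) + C₁ * x ^ 2 := (abs_add_le _ _).trans (add_le_add hp' this)
    _ ≤ _ := by
      have : 0 ≤ C₁ * (1 / M) := by positivity
      have : 0 ≤ K * C₂ * x ^ 2 := by positivity
      linarith

lemma abs_div_add_mul_le_of_approx {α c P Q x E : ℝ} (hα : 0 < α) (hc : 0 < c)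
    (hPQ : c ≤ P + Q) (hx : |x| ≤ 1) (hP : |P - 1 + α * x| ≤ E) (hQ : |Q - 1 - α * x| ≤ E) :
    |(P - Q) / (P + Q) + α * x| ≤ 2 * (1 + α) * E / c := by
  have hS : 0 < P + Q := by linarith
  have e : (P - Q) / (P + Q) + α * x = ((1 + α * x) * (P - 1 + α * x) -
      (1 - α * x) * (Q - 1 - α * x)) / (P + Q) := by
    field_simp; ring
  have hax : |α * x| ≤ α := by
    rw [abs_mul, abs_of_pos hα]; nlinarith
  have hax' := abs_le.1 hax
  have hE : 0 ≤ E := (abs_nonneg _).trans hP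
  rw [e, abs_div, abs_of_pos hS]
  refine div_le_div₀ (by positivity) ((abs_sub _ _).trans ?_) hc hPQ
  rw [abs_mul, abs_mul]
  have i1 : |1 + α * x| ≤ 1 + α := by rw [abs_le]; constructor <;> linarith
  have i2 : |1 - α * x| ≤ 1 + α := by rw [abs_le]; constructor <;> linarith
  have j1 := mul_le_mul i1 hP (abs_nonneg _) (by positivity)
  have j2 := mul_le_mul i2 hQ (abs_nonneg _) (by positivity)
  linarith

set_option maxHeartbeats 800000 in
lemma exists_abs_div_add_linear_le {α K c : ℝ} (hα : 0 < α) (hK : 0 < K) (hc : 0 < c) :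
    ∃ C > 0, ∀ p q : ℕ → ℝ, (∀ i, 0 < p i) → (∀ i, 0 < q i) →
      RegularGrowth α K c p → RegularGrowth α K c q → ∀ i j : ℕ, 0 < i + j →
      |(p i - q j) / (p i + q j) + α * (((j : ℝ) - i) / (i + j))|
        ≤ C * (1 / ((i : ℝ) + j) + (((j : ℝ) - i) / (i + j)) ^ 2) := by
  obtain ⟨C₁, hC₁, h₁⟩ := exists_abs_div_rpow_sub_le α hK
  set A : ℝ := 4 * C₁ * (1 + α) / c with hA
  have hA0 : 0 < A := by positivity
  refine ⟨A + 4 * (1 + α) + 2 * α, by positivity, fun p q hp0 hq0 hp hq i j hij => ?_⟩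
  have hn : (1 : ℝ) ≤ (i : ℝ) + j := by exact_mod_cast hij
  have hi : (0 : ℝ) ≤ i := i.cast_nonneg
  have hj : (0 : ℝ) ≤ j := j.cast_nonneg
  set n : ℝ := (i : ℝ) + j with hndef
  set M : ℝ := (n + 2) / 2 with hM
  have hM0 : 0 < M := by positivity
  set d : ℝ := (j : ℝ) - i with hd
  have hdn : |d| ≤ n := by rw [abs_le]; constructor <;> linarith
  set x : ℝ := d / (n + 2) with hx
  have hxM : M * x = d / 2 := by rw [hM, hx]; field_simp
  have hxn : |x| ≤ |d / n| := by
    rw [hx, abs_div, abs_div, abs_of_pos (by linarith : 0 < n), abs_of_pos (by linarith : 0 < n + 2)]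
    gcongr; linarith
  have hxn2 : x ^ 2 ≤ (d / n) ^ 2 := sq_le_sq.2 hxn
  have hdiff : |d / n - x| ≤ 2 * (1 / n) := by
    have : d / n - x = (d / n) * (2 / (n + 2)) := by rw [hx]; field_simp; ring
    rw [this, abs_mul, abs_div, abs_of_pos (by linarith : 0 < n),
      abs_of_pos (by positivity : 0 < 2 / (n + 2))]
    have h1 : |d| / n ≤ 1 := by rw [div_le_one (by linarith)]; exact hdn
    have h2 : 2 / (n + 2) ≤ 2 * (1 / n) := by
      rw [mul_one_div]; gcongr; linarith
    have h3 : 0 ≤ 2 / (n + 2) := by positivity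
    nlinarith [abs_nonneg d]
  have hpq : 0 < p i + q j := add_pos (hp0 i) (hq0 j)
  have hmain : |(p i - q j) / (p i + q j) + α * x| ≤ (A + 4 * (1 + α)) * (1 / n + x ^ 2) := by
    have hn' : 0 < 1 / n := by positivity
    rcases le_or_gt |x| (1 / 2) with hx2 | hx2
    · have ei : (i : ℝ) + 1 = M * (1 + -x) := by
        have : M * (1 + -x) = M - M * x := by ring
        rw [this, hxM, hM, hndef, hd]; ring
      have ej : (j : ℝ) + 1 = M * (1 + x) := by
        have : M * (1 + x) = M + M * x := by ring
        rw [this, hxM, hM, hndef, hd]; ring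
      have hpi := (hp i)
      have hqj := (hq j)
      rw [ei] at hpi
      rw [ej] at hqj
      have h2 := h₁ M (p i) (-x) hM0 (by rwa [abs_neg]) hpi.1
      have h3 := h₁ M (q j) x hM0 hx2 hqj.1
      have hMa : 0 < M ^ α := by positivity
      set P := p i / M ^ α with hP
      set Q := q j / M ^ α with hQ
      have hxb := abs_le.1 hx2
      have hPQ : c ≤ P + Q := by
        have hP0 : 0 < P := div_pos (hp0 i) hMa
        have hQ0 : 0 < Q := div_pos (hq0 j) hMa
        have e1 := hpi.2
        have e2 := hqj.2
        rw [Real.mul_rpow hM0.le (by linarith)] at e1 e2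
        rcases le_total x 0 with h0 | h0
        · have : c * (1 + -x) ^ α ≤ P := by rw [hP, le_div_iff₀ hMa]; linarith
          have := Real.one_le_rpow (by linarith : 1 ≤ 1 + -x) hα.le
          nlinarith
        · have : c * (1 + x) ^ α ≤ Q := by rw [hQ, le_div_iff₀ hMa]; linarith
          have := Real.one_le_rpow (by linarith : 1 ≤ 1 + x) hα.le
          nlinarith
      have e : (p i - q j) / (p i + q j) = (P - Q) / (P + Q) := by
        rw [hP, hQ]; field_simp
      have hMn : 1 / M ≤ 2 * (1 / n) := by
        rw [hM, one_div_div, mul_one_div]; gcongr; linarith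
      have hEn : C₁ * (x ^ 2 + 1 / M) ≤ 2 * C₁ * (1 / n + x ^ 2) := by
        have h5 : x ^ 2 + 1 / M ≤ 2 * (1 / n + x ^ 2) := by linarith [sq_nonneg x]
        calc _ ≤ C₁ * (2 * (1 / n + x ^ 2)) := by gcongr
          _ = _ := by ring
      rw [neg_sq, mul_neg, sub_neg_eq_add] at h2
      rw [e]
      refine (abs_div_add_mul_le_of_approx hα hc hPQ (by linarith) (h2.trans hEn)
        (h3.trans hEn)).trans ?_
      have hy : 0 < 1 / n + x ^ 2 := by positivity
      have e2 : 2 * (1 + α) * (2 * C₁ * (1 / n + x ^ 2)) / c = A * (1 / n + x ^ 2) := by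
        rw [hA]; ring
      rw [e2]
      gcongr; linarith
    · have h1 : |(p i - q j) / (p i + q j)| ≤ 1 := by
        rw [abs_div, abs_of_pos hpq, div_le_one hpq, abs_le]
        constructor <;> linarith [hp0 i, hq0 j]
      have hx1 : |x| ≤ 1 := by
        refine hxn.trans ?_
        rw [abs_div, abs_of_pos (by linarith : 0 < n), div_le_one (by linarith)]; exact hdn
      have h2 : |α * x| ≤ α := by rw [abs_mul, abs_of_pos hα]; nlinarith
      have h3 : 1 / 4 ≤ x ^ 2 := by rw [← sq_abs]; nlinarith
      refine (abs_add_le _ _).trans ?_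
      nlinarith [mul_pos hA0 hn', mul_nonneg hA0.le (sq_nonneg x)]
  have e : (p i - q j) / (p i + q j) + α * (d / n)
      = ((p i - q j) / (p i + q j) + α * x) + α * (d / n - x) := by ring
  rw [e]
  refine (abs_add_le _ _).trans ?_
  rw [abs_mul α, abs_of_pos hα]
  have h1 := mul_le_mul_of_nonneg_left hdiff hα.le
  have h2 : (A + 4 * (1 + α)) * (1 / n + x ^ 2) ≤ (A + 4 * (1 + α)) * (1 / n + (d / n) ^ 2) := by
    gcongr
  have h3 : 0 ≤ 2 * α * (d / n) ^ 2 := by positivity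
  linarith

lemma exists_sub_mul_sub_le {α K c : ℝ} (hα : 0 < α) (hK : 0 < K) (hc : 0 < c) :
    ∃ C > 0, ∀ u v p q : ℝ, 1 ≤ u → u ≤ v → 0 < p →
      |p - u ^ α| ≤ K * u ^ (α - 1) → |q - v ^ α| ≤ K * v ^ (α - 1) → c * v ^ α ≤ q →
      (v - u) * (p - q) ≤ C * (p + q) := by
  obtain ⟨L, hL, hmain⟩ : ∃ L > 0, ∀ u v : ℝ, 1 ≤ u → u ≤ v →
      (v - u) * (u ^ α - v ^ α + K * u ^ (α - 1)) ≤ L * v ^ α := by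
    obtain ⟨C, hC, hCb⟩ := exists_rpow_one_add_le (α - 1)
    set η : ℝ := 1 - (1 / 2) ^ α with hη
    have hη0 : 0 < η := by
      have := Real.rpow_lt_one (by norm_num : (0 : ℝ) ≤ 1 / 2) (by norm_num) hα
      linarith
    set V : ℝ := (K / η) ^ α⁻¹ with hV
    have hV0 : 0 < V := by positivity
    refine ⟨K * C + K + K * V, by positivity, fun u v hu huv => ?_⟩
    have hu0 : 0 < u := by linarith
    have hv : 0 < v := by linarith
    have hva : v * v ^ (α - 1) = v ^ α := by
      rw [Real.rpow_sub_one hv.ne']; field_simp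
    have hva0 : 0 < v ^ α := by positivity
    have huva : u ^ α ≤ v ^ α := Real.rpow_le_rpow hu0.le huv hα.le
    have key : ∀ T > 0, u ^ (α - 1) ≤ T * v ^ (α - 1) →
        (v - u) * (u ^ α - v ^ α + K * u ^ (α - 1)) ≤ K * T * v ^ α := by
      intro T hT h
      calc (v - u) * (u ^ α - v ^ α + K * u ^ (α - 1))
          ≤ (v - u) * (K * u ^ (α - 1)) :=
            mul_le_mul_of_nonneg_left (by linarith) (by linarith)
        _ ≤ v * (K * (T * v ^ (α - 1))) :=
            mul_le_mul (by linarith) (by gcongr) (by positivity) hv.le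
        _ = K * T * v ^ α := by rw [← hva]; ring
    have hKC : 0 < K * C * v ^ α := by positivity
    have hK1 : 0 < K * v ^ α := by positivity
    have hKV : 0 < K * V * v ^ α := by positivity
    rcases le_or_gt (v / 2) u with h2 | h2
    · have h3 : |u / v - 1| ≤ 1 / 2 := by
        have e1 : u / v ≤ 1 := by rw [div_le_one hv]; exact huv
        have e2 : 1 / 2 ≤ u / v := by rw [le_div_iff₀ hv]; linarith
        rw [abs_le]; constructor <;> linarith
      have h4 := hCb _ h3
      rw [add_sub_cancel, Real.div_rpow hu0.le hv.le, div_le_iff₀ (by positivity)] at h4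
      linarith [key C hC h4]
    rcases le_or_gt 1 α with h1 | h1
    · have := Real.rpow_le_rpow hu0.le huv (by linarith : 0 ≤ α - 1)
      linarith [key 1 one_pos (by linarith)]
    · have hu1 : u ^ (α - 1) ≤ 1 := Real.rpow_le_one_of_one_le_of_nonpos hu (by linarith)
      have hu2 : u ^ α ≤ (1 - η) * v ^ α := by
        have : u ^ α ≤ (1 / 2 * v) ^ α := Real.rpow_le_rpow hu0.le (by linarith) hα.le
        rw [Real.mul_rpow (by norm_num) hv.le] at this
        rw [hη]; linarith
      have h5 : u ^ α - v ^ α + K * u ^ (α - 1) ≤ K - η * v ^ α := by nlinarith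
      refine (mul_le_mul_of_nonneg_left h5 (by linarith)).trans ?_
      rcases le_or_gt K (η * v ^ α) with h6 | h6
      · have : (v - u) * (K - η * v ^ α) ≤ 0 :=
          mul_nonpos_of_nonneg_of_nonpos (by linarith) (by linarith)
        linarith
      · have h7 : v ≤ V := by
          have h8 : v ^ α ≤ K / η := by rw [le_div_iff₀ hη0]; linarith
          have := Real.rpow_le_rpow hva0.le h8 (inv_nonneg.2 hα.le)
          rwa [Real.rpow_rpow_inv hv.le hα.ne'] at this
        have h9 : 1 ≤ v ^ α := Real.one_le_rpow (by linarith) hα.le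
        have h10 : (v - u) * (K - η * v ^ α) ≤ V * K :=
          mul_le_mul (by linarith) (by nlinarith) (by linarith) hV0.le
        have h11 : V * K ≤ K * V * v ^ α := by
          have : 0 < V * K := by positivity
          nlinarith
        linarith
  refine ⟨(L + K) / c, by positivity, fun u v p q hu huv hp0 hp hq hcq => ?_⟩
  have hv : 0 < v := by linarith
  have hva : v * v ^ (α - 1) = v ^ α := by
    rw [Real.rpow_sub_one hv.ne']; field_simp
  have h1 := hmain u v hu huv
  have h2 := (abs_le.1 hp).2
  have h3 := (abs_le.1 hq).1
  have h4 : (v - u) * (p - q)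
      ≤ (v - u) * (u ^ α - v ^ α + K * u ^ (α - 1) + K * v ^ (α - 1)) :=
    mul_le_mul_of_nonneg_left (by linarith) (by linarith)
  have h5 : 0 ≤ u * (K * v ^ (α - 1)) := by positivity
  have h6 : (L + K) * v ^ α ≤ (L + K) / c * q := by
    rw [div_mul_eq_mul_div, le_div_iff₀ hc]
    nlinarith
  have h7 : 0 < (L + K) / c * p := by positivity
  nlinarith

lemma exists_div_mul_le {α K c : ℝ} (hα : 0 < α) (hK : 0 < K) (hc : 0 < c) :
    ∃ C > 0, ∀ p q : ℕ → ℝ, (∀ i, 0 < p i) → (∀ i, 0 < q i) →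
      RegularGrowth α K c p → RegularGrowth α K c q → ∀ i j : ℕ,
      ((j : ℝ) - i) * ((p i - q j) / (p i + q j)) ≤ C := by
  obtain ⟨C, hC, h⟩ := exists_sub_mul_sub_le hα hK hc
  refine ⟨C, hC, fun p q hp0 hq0 hp hq i j => ?_⟩
  have hpi := hp i
  have hqj := hq j
  have hi : (0 : ℝ) ≤ i := i.cast_nonneg
  have hj : (0 : ℝ) ≤ j := j.cast_nonneg
  rw [mul_div_assoc', div_le_iff₀ (add_pos (hp0 i) (hq0 j))]
  rcases le_total (i : ℝ) j with hij | hij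
  · have := h (i + 1) (j + 1) (p i) (q j) (by linarith) (by linarith) (hp0 i) hpi.1 hqj.1 hqj.2
    linarith
  · have := h (j + 1) (i + 1) (q j) (p i) (by linarith) (by linarith) (hq0 j) hqj.1 hpi.1 hpi.2
    linarith

lemma exists_regularGrowth_of_weightAsymp {w : ℕ → ℝ} {α B : ℝ} (hw : ∀ n, 0 < w n)
    (h : WeightAsymp w α B) (e : ℕ) (he : e ≤ 1) :
    ∃ K > 0, ∃ c > 0, RegularGrowth α K c (fun i => 1 / (2 ^ α * w (2 * i + e))) := by
  obtain ⟨C₀, hC₀, N₀, hN⟩ := h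
  obtain ⟨C₁, hC₁, h₁⟩ := exists_abs_rpow_one_add_sub_one_le α
  obtain ⟨C₂, hC₂, h₂⟩ := exists_rpow_one_add_le (α - 1)
  obtain ⟨C₃, hC₃, h₃⟩ := exists_rpow_one_add_le (α - 2)
  set p : ℕ → ℝ := fun i => 1 / (2 ^ α * w (2 * i + e)) with hp
  have hp0 : ∀ i, 0 < p i := fun i => by have := hw (2 * i + e); simp only [hp]; positivity
  have he' : (e : ℝ) ≤ 1 := by exact_mod_cast he
  have he0 : (0 : ℝ) ≤ e := e.cast_nonneg
  have hO : (fun i : ℕ => p i - ((i : ℝ) + 1) ^ α) =O[atTop]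
      fun i : ℕ => ((i : ℝ) + 1) ^ (α - 1) := by
    refine Asymptotics.IsBigO.of_bound (C₁ + 2 * |B| * C₂ + C₀ * C₃) ?_
    filter_upwards [eventually_ge_atTop (N₀ + 1)] with i hi
    have hi1 : (1 : ℝ) ≤ i := by exact_mod_cast (by omega : 1 ≤ i)
    set u : ℝ := (i : ℝ) + 1 with hu
    have hu0 : 0 < u := by positivity
    set y : ℝ := -((2 - e) / (2 * u)) with hy
    have hyu : |y| ≤ 1 / u := by
      rw [hy, abs_neg, abs_of_nonneg (div_nonneg (by linarith) (by positivity)),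
        div_le_div_iff₀ (by positivity) hu0]
      nlinarith
    have hy2 : |y| ≤ 1 / 2 := hyu.trans (by gcongr; linarith)
    have hy1 : 0 ≤ 1 + y := by linarith [(abs_le.1 hy2).1]
    have ht : ((2 * i + e : ℕ) : ℝ) = (2 * u) * (1 + y) := by
      push_cast; rw [hy]; field_simp; ring
    have hU : 0 < 2 * u := by positivity
    have hmain := hN (2 * i + e) (by omega)
    rw [ht, Real.mul_rpow hU.le hy1, Real.mul_rpow hU.le hy1, Real.mul_rpow hU.le hy1,
      Real.rpow_sub_one hU.ne', show α - 2 = α - 1 - 1 by ring, Real.rpow_sub_one hU.ne',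
      Real.rpow_sub_one hU.ne', show α - 1 - 1 = α - 2 by ring] at hmain
    have hua : 0 < u ^ α := by positivity
    have h2a : (0 : ℝ) < 2 ^ α := by positivity
    have h2u : (2 * u) ^ α = 2 ^ α * u ^ α := Real.mul_rpow (by norm_num) hu0.le
    rw [Real.norm_eq_abs, Real.norm_eq_abs, Real.rpow_sub_one hu0.ne',
      abs_of_pos (by positivity : 0 < u ^ α / u)]
    have a1 := h₁ y hy2
    have a2 := h₂ y hy2
    have a3 := h₃ y hy2
    have a2' : 0 ≤ (1 + y) ^ (α - 1) := by positivity
    have a3' : 0 ≤ (1 + y) ^ (α - 2) := by positivity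
    set W := w (2 * i + e)
    have hW : 0 < W := hw _
    have hpi : p i = 1 / W / 2 ^ α := by change 1 / (2 ^ α * W) = _; field_simp
    rw [hpi]
    have split : 1 / W / 2 ^ α - u ^ α =
        (1 / W - (2 * u) ^ α * (1 + y) ^ α - 2 * B * ((2 * u) ^ α / (2 * u) * (1 + y) ^ (α - 1)))
          / 2 ^ α + u ^ α * ((1 + y) ^ α - 1) + B * (u ^ α / u * (1 + y) ^ (α - 1)) := by
      rw [h2u]; field_simp; ring
    rw [split]
    refine (abs_add_three _ _ _).trans ?_
    have b1 : |(1 / W - (2 * u) ^ α * (1 + y) ^ α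
        - 2 * B * ((2 * u) ^ α / (2 * u) * (1 + y) ^ (α - 1))) / 2 ^ α| ≤ C₀ * C₃ * (u ^ α / u) := by
      rw [abs_div, abs_of_pos h2a, div_le_iff₀ h2a]
      refine hmain.trans ?_
      rw [h2u]
      calc C₀ * (2 ^ α * u ^ α / (2 * u) / (2 * u) * (1 + y) ^ (α - 2))
          ≤ C₀ * (2 ^ α * u ^ α / u / 1 * C₃) := by
            gcongr <;> linarith
        _ = _ := by ring
    have b2 : |u ^ α * ((1 + y) ^ α - 1)| ≤ C₁ * (u ^ α / u) := by
      rw [abs_mul, abs_of_pos hua]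
      calc u ^ α * |(1 + y) ^ α - 1| ≤ u ^ α * (C₁ * (1 / u)) := by
            gcongr; exact a1.trans (by gcongr)
        _ = _ := by ring
    have b3 : |B * (u ^ α / u * (1 + y) ^ (α - 1))| ≤ 2 * |B| * C₂ * (u ^ α / u) := by
      rw [abs_mul, abs_mul, abs_of_nonneg a2', abs_of_pos (by positivity : 0 < u ^ α / u)]
      calc |B| * (u ^ α / u * (1 + y) ^ (α - 1)) ≤ |B| * (u ^ α / u * C₂) := by gcongr
        _ ≤ 2 * (|B| * (u ^ α / u * C₂)) := by
          have : 0 ≤ |B| * (u ^ α / u * C₂) := by positivity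
          linarith
        _ = _ := by ring
    linarith
  obtain ⟨K, hK, hKb⟩ := Asymptotics.bound_of_isBigO_nat_atTop hO
  have hb : ∀ i : ℕ, |p i - ((i : ℝ) + 1) ^ α| ≤ K * ((i : ℝ) + 1) ^ (α - 1) := fun i => by
    have h0 : 0 < ((i : ℝ) + 1) ^ (α - 1) := by positivity
    simpa [abs_of_pos h0] using hKb h0.ne'
  have hO2 : (fun i : ℕ => ((i : ℝ) + 1) ^ α) =O[atTop] p := by
    refine Asymptotics.IsBigO.of_bound 2 ?_
    filter_upwards [tendsto_natCast_atTop_atTop.eventually_ge_atTop (2 * K)] with i hi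
    have hu0 : 0 < (i : ℝ) + 1 := by positivity
    have h0 : 0 < ((i : ℝ) + 1) ^ α := by positivity
    have h1 := (abs_le.1 (hb i)).1
    rw [Real.norm_eq_abs, Real.norm_eq_abs, abs_of_pos h0, abs_of_pos (hp0 i)]
    have : K * ((i : ℝ) + 1) ^ (α - 1) ≤ ((i : ℝ) + 1) ^ α / 2 := by
      rw [Real.rpow_sub_one hu0.ne', mul_div_assoc', div_le_div_iff₀ hu0 two_pos]
      nlinarith
    linarith
  obtain ⟨L, hL, hLb⟩ := Asymptotics.bound_of_isBigO_nat_atTop hO2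
  refine ⟨K, hK, 1 / L, by positivity, fun i => ⟨hb i, ?_⟩⟩
  have h0 : 0 < ((i : ℝ) + 1) ^ α := by positivity
  have := hLb (hp0 i).ne'
  rw [Real.norm_eq_abs, Real.norm_eq_abs, abs_of_pos h0, abs_of_pos (hp0 i)] at this
  rw [one_div_mul_eq_div, div_le_iff₀ hL]
  linarith

lemma RegularGrowth.mono {α K c K' c' : ℝ} {p : ℕ → ℝ} (h : RegularGrowth α K c p)
    (hK : K ≤ K') (hc : c' ≤ c) : RegularGrowth α K' c' p := fun i =>
  ⟨(h i).1.trans (by gcongr), (by gcongr : c' * ((i : ℝ) + 1) ^ α ≤ _).trans (h i).2⟩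

/-- The expected increment of the discrepancy from the state `(i, j)`. -/
noncomputable def drift (b r : ℕ → ℝ) (i j : ℕ) : ℝ := 1 - 2 * (b i / (b i + r j))

lemma abs_drift_le_one {b r : ℕ → ℝ} (hb : ∀ i, 0 < b i) (hr : ∀ i, 0 < r i) (i j : ℕ) :
    |drift b r i j| ≤ 1 := by
  have h0 : 0 ≤ b i / (b i + r j) := div_nonneg (hb i).le (add_pos (hb i) (hr j)).le
  have h1 : b i / (b i + r j) ≤ 1 := by
    rw [div_le_one (add_pos (hb i) (hr j))]; linarith [hr j]
  rw [drift, abs_le]; constructor <;> linarith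

lemma exists_drift_bounds {w b r : ℕ → ℝ} {α B : ℝ} (hα : 0 < α) (hw : ∀ n, 0 < w n)
    (hasymp : WeightAsymp w α B) (hchoice : UrnChoice w b r) :
    ∃ C > 0, (∀ i j : ℕ, 0 < i + j → |drift b r i j + α * (((j : ℝ) - i) / (i + j))|
        ≤ C * (1 / ((i : ℝ) + j) + (((j : ℝ) - i) / (i + j)) ^ 2)) ∧
      ∀ i j : ℕ, ((j : ℝ) - i) * drift b r i j ≤ C := by
  obtain ⟨e, f, he, hf, hb, hr⟩ : ∃ e f : ℕ, e ≤ 1 ∧ f ≤ 1 ∧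
      (∀ i, b i = w (2 * i + e)) ∧ ∀ i, r i = w (2 * i + f) := by
    rcases hchoice with h | h | h
    · exact ⟨0, 1, by simp, by simp, fun i => (h i).1, fun i => (h i).2⟩
    · exact ⟨1, 0, by simp, by simp, fun i => (h i).1, fun i => (h i).2⟩
    · exact ⟨0, 0, by simp, by simp, fun i => (h i).1, fun i => (h i).2⟩
  obtain ⟨K₁, hK₁, c₁, hc₁, h₁⟩ := exists_regularGrowth_of_weightAsymp hw hasymp e he
  obtain ⟨K₂, hK₂, c₂, hc₂, h₂⟩ := exists_regularGrowth_of_weightAsymp hw hasymp f hf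
  replace h₁ := h₁.mono (le_max_left K₁ K₂) (min_le_left c₁ c₂)
  replace h₂ := h₂.mono (le_max_right K₁ K₂) (min_le_right c₁ c₂)
  have hK : 0 < max K₁ K₂ := lt_max_of_lt_left hK₁
  have hc : 0 < min c₁ c₂ := lt_min hc₁ hc₂
  obtain ⟨A, hA, hAb⟩ := exists_abs_div_add_linear_le hα hK hc
  obtain ⟨A', hA', hAb'⟩ := exists_div_mul_le hα hK hc
  have hp : ∀ g i : ℕ, 0 < 1 / (2 ^ α * w (2 * i + g)) := fun g i => by
    have := hw (2 * i + g); positivity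
  have e : ∀ i j, drift b r i j =
      (1 / (2 ^ α * w (2 * i + e)) - 1 / (2 ^ α * w (2 * j + f)))
        / (1 / (2 ^ α * w (2 * i + e)) + 1 / (2 ^ α * w (2 * j + f))) := by
    intro i j
    have h1 := hw (2 * i + e)
    have h2 := hw (2 * j + f)
    have h3 : 0 < w (2 * i + e) + w (2 * j + f) := by linarith
    have h4 : 0 < w (2 * j + f) + w (2 * i + e) := by linarith
    rw [drift, hb, hr]; field_simp; ring
  refine ⟨max A A', lt_max_of_lt_left hA, fun i j hij => ?_, fun i j => ?_⟩
  · rw [e]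
    refine (hAb _ _ (hp _) (hp _) h₁ h₂ i j hij).trans ?_
    gcongr; exact le_max_left _ _
  · rw [e]
    exact (hAb' _ _ (hp _) (hp _) h₁ h₂ i j).trans (le_max_right _ _)

/-- Bounded functions that are measurable with respect to `m`. -/
def BoundedMeasurable {Ω : Type*} (m : MeasurableSpace Ω) (f : Ω → ℝ) : Prop :=
  Measurable[m] f ∧ ∃ C, ∀ ω, |f ω| ≤ C

namespace BoundedMeasurable

variable {Ω : Type*} {m : MeasurableSpace Ω} {f g : Ω → ℝ}

lemma const (c : ℝ) : BoundedMeasurable m (fun _ => c) := ⟨measurable_const, |c|, fun _ => le_rfl⟩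

lemma add (hf : BoundedMeasurable m f) (hg : BoundedMeasurable m g) :
    BoundedMeasurable m (fun ω => f ω + g ω) := by
  obtain ⟨hf, C, hC⟩ := hf
  obtain ⟨hg, C', hC'⟩ := hg
  exact ⟨hf.add hg, C + C', fun ω => (abs_add_le _ _).trans (add_le_add (hC ω) (hC' ω))⟩

lemma mul (hf : BoundedMeasurable m f) (hg : BoundedMeasurable m g) :
    BoundedMeasurable m (fun ω => f ω * g ω) := by
  obtain ⟨hf, C, hC⟩ := hf
  obtain ⟨hg, C', hC'⟩ := hg
  refine ⟨hf.mul hg, C * C', fun ω => ?_⟩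
  rw [abs_mul]
  exact mul_le_mul (hC ω) (hC' ω) (abs_nonneg _) ((abs_nonneg _).trans (hC ω))

lemma const_mul (c : ℝ) (hf : BoundedMeasurable m f) : BoundedMeasurable m (fun ω => c * f ω) :=
  (const c).mul hf

lemma sub (hf : BoundedMeasurable m f) (hg : BoundedMeasurable m g) :
    BoundedMeasurable m (fun ω => f ω - g ω) := by
  simpa [sub_eq_add_neg] using hf.add (hg.const_mul (-1))

lemma pow (hf : BoundedMeasurable m f) (k : ℕ) : BoundedMeasurable m (fun ω => f ω ^ k) := by
  induction k with
  | zero => simpa using const 1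
  | succ k ih => simpa [pow_succ] using ih.mul hf

lemma sum {ι : Type*} {s : Finset ι} {F : ι → Ω → ℝ} (h : ∀ i ∈ s, BoundedMeasurable m (F i)) :
    BoundedMeasurable m (fun ω => ∑ i ∈ s, F i ω) := by
  classical
  induction s using Finset.induction_on with
  | empty => simpa using const 0
  | insert a s ha ih =>
    simp only [Finset.sum_insert ha]
    exact (h a (by simp)).add (ih fun i hi => h i (by simp [hi]))

lemma mono {m' : MeasurableSpace Ω} (hf : BoundedMeasurable m f) (h : m ≤ m') :
    BoundedMeasurable m' f := ⟨hf.1.mono h le_rfl, hf.2⟩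

lemma integrable (hf : BoundedMeasurable m f) {μ : Measure Ω} [IsFiniteMeasure μ] :
    Integrable f μ := by
  obtain ⟨hf, C, hC⟩ := hf
  exact Integrable.of_bound hf.aestronglyMeasurable C (ae_of_all _ hC)

lemma memLp (hf : BoundedMeasurable m f) {μ : Measure Ω} [IsFiniteMeasure μ] (p : ENNReal) :
    MemLp f p μ := by
  obtain ⟨hf, C, hC⟩ := hf
  exact MemLp.of_bound hf.aestronglyMeasurable C (ae_of_all _ hC)

end BoundedMeasurable

lemma abs_variance_add_sub_le {Ω : Type*} {m : MeasurableSpace Ω} {μ : Measure Ω}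
    [IsProbabilityMeasure μ] {S R : Ω → ℝ} (hS : BoundedMeasurable m S)
    (hR : BoundedMeasurable m R) (hS0 : ∫ ω, S ω ∂μ = 0) {t : ℝ} (ht : 0 < t) :
    |variance (fun ω => S ω + R ω) μ - ∫ ω, S ω ^ 2 ∂μ|
      ≤ (∫ ω, S ω ^ 2 ∂μ) / t + (t + 1) * ∫ ω, R ω ^ 2 ∂μ := by
  have hSR := hS.mul hR
  have hvar := variance_eq_sub ((hS.add hR).memLp (μ := μ) 2)
  have e1 : ∫ ω, (S ω + R ω) ^ 2 ∂μ
      = ∫ ω, S ω ^ 2 ∂μ + 2 * ∫ ω, S ω * R ω ∂μ + ∫ ω, R ω ^ 2 ∂μ := by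
    rw [← integral_const_mul, ← integral_add (hS.pow 2).integrable (hSR.const_mul 2).integrable,
      ← integral_add ((hS.pow 2).add (hSR.const_mul 2)).integrable (hR.pow 2).integrable]
    congr 1; ext ω; ring
  have e2 : ∫ ω, (S ω + R ω) ∂μ = ∫ ω, R ω ∂μ := by
    rw [integral_add hS.integrable hR.integrable, hS0, zero_add]
  have e3 : (∫ ω, R ω ∂μ) ^ 2 ≤ ∫ ω, R ω ^ 2 ∂μ := by
    have h1 := variance_eq_sub (hR.memLp (μ := μ) 2)
    have h2 := variance_nonneg R μ
    simp only [Pi.pow_apply] at h1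
    linarith
  have e4 : |2 * ∫ ω, S ω * R ω ∂μ| ≤ (∫ ω, S ω ^ 2 ∂μ) / t + t * ∫ ω, R ω ^ 2 ∂μ := by
    rw [← integral_const_mul, ← integral_div, ← integral_const_mul,
      ← integral_add ((hS.pow 2).integrable.div_const t) ((hR.pow 2).const_mul t).integrable]
    refine (abs_integral_le_integral_abs).trans (integral_mono (hSR.const_mul 2).integrable.abs
      (((hS.pow 2).integrable.div_const t).add ((hR.pow 2).const_mul t).integrable) fun ω => ?_)
    have i1 : S ω ^ 2 / t + t * R ω ^ 2 - 2 * (S ω * R ω) = (S ω - t * R ω) ^ 2 / t := by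
      field_simp; ring
    have i2 : S ω ^ 2 / t + t * R ω ^ 2 + 2 * (S ω * R ω) = (S ω + t * R ω) ^ 2 / t := by
      field_simp; ring
    have i3 : 0 ≤ (S ω - t * R ω) ^ 2 / t := by positivity
    have i4 : 0 ≤ (S ω + t * R ω) ^ 2 / t := by positivity
    simp only
    rw [abs_le]; constructor <;> linarith
  simp only [Pi.pow_apply] at hvar
  rw [hvar, e1, e2]
  have := abs_le.1 e4
  have := sq_nonneg (∫ ω, R ω ∂μ)
  rw [abs_le]; constructor <;> linarith

lemma abs_sum_rpow_sub_integral_le {β n : ℝ} (hβ : 0 < β) (hn : 0 < n) {k m : ℕ} (hkm : k ≤ m) :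
    |∑ j ∈ Finset.Ico k m, (((j + 1 : ℕ) : ℝ) / n) ^ β - n * ∫ u in ((k : ℝ) / n)..((m : ℝ) / n), u ^ β|
      ≤ ((m : ℝ) / n) ^ β := by
  have hII : ∀ a b : ℝ, IntervalIntegrable (fun u : ℝ => u ^ β) volume a b := fun a b =>
    intervalIntegral.intervalIntegrable_rpow' (by linarith)
  suffices h : 0 ≤ ∑ j ∈ Finset.Ico k m, (((j + 1 : ℕ) : ℝ) / n) ^ β
        - n * ∫ u in ((k : ℝ) / n)..((m : ℝ) / n), u ^ β ∧
      ∑ j ∈ Finset.Ico k m, (((j + 1 : ℕ) : ℝ) / n) ^ β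
        - n * ∫ u in ((k : ℝ) / n)..((m : ℝ) / n), u ^ β
        ≤ ((m : ℝ) / n) ^ β - ((k : ℝ) / n) ^ β by
    have : 0 ≤ ((k : ℝ) / n) ^ β := by positivity
    rw [abs_of_nonneg h.1]
    linarith [h.2]
  induction m, hkm using Nat.le_induction with
  | base => simp
  | succ m hkm ih =>
    rw [Finset.sum_Ico_succ_top hkm,
      ← intervalIntegral.integral_add_adjacent_intervals (hII _ ((m : ℝ) / n)) (hII _ _), mul_add]
    have hle : (m : ℝ) / n ≤ ((m + 1 : ℕ) : ℝ) / n := by gcongr; simp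
    have hlen : ((m + 1 : ℕ) : ℝ) / n - (m : ℝ) / n = 1 / n := by push_cast; ring
    have hm0 : (0 : ℝ) ≤ (m : ℝ) / n := by positivity
    have h1 : ((m : ℝ) / n) ^ β ≤ n * ∫ u in ((m : ℝ) / n)..(((m + 1 : ℕ) : ℝ) / n), u ^ β := by
      have := intervalIntegral.integral_mono_on hle (intervalIntegrable_const (c := ((m : ℝ) / n) ^ β))
        (hII _ _) fun x hx => Real.rpow_le_rpow hm0 hx.1 hβ.le
      rw [intervalIntegral.integral_const, hlen, smul_eq_mul, one_div_mul_eq_div,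
        div_le_iff₀ hn] at this
      linarith
    have h2 : n * ∫ u in ((m : ℝ) / n)..(((m + 1 : ℕ) : ℝ) / n), u ^ β
        ≤ (((m + 1 : ℕ) : ℝ) / n) ^ β := by
      have := intervalIntegral.integral_mono_on hle (hII _ _)
        (intervalIntegrable_const (c := (((m + 1 : ℕ) : ℝ) / n) ^ β))
        fun x hx => Real.rpow_le_rpow (hm0.trans hx.1) hx.2 hβ.le
      rw [intervalIntegral.integral_const, hlen, smul_eq_mul, one_div_mul_eq_div,
        le_div_iff₀ hn] at this
      linarith
    constructor <;> linarith [ih.1, ih.2]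

lemma exists_abs_mul_one_sub_rpow_add_le (α : ℝ) (hα : 0 < α) :
    ∃ C > 0, ∀ j : ℕ, 0 < j → ∀ d g : ℝ, |d| ≤ j →
      |d * (1 - ((j : ℝ) / (j + 1 : ℕ)) ^ α) + g| ≤ |g + α * (d / j)| + C * (1 / j) := by
  obtain ⟨C, hC, h⟩ := exists_abs_rpow_one_add_sub_linear_le α
  refine ⟨C + α, by positivity, fun j hj d g hd => ?_⟩
  have hj1 : (1 : ℝ) ≤ j := by exact_mod_cast hj
  have hj0 : (0 : ℝ) < j := by linarith
  set y : ℝ := -(1 / ((j : ℝ) + 1)) with hy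
  have hyj : |y| ≤ 1 / j := by
    rw [hy, abs_neg, abs_of_pos (by positivity)]; gcongr; linarith
  have hy2 : |y| ≤ 1 / 2 := by
    rw [hy, abs_neg, abs_of_pos (by positivity)]; gcongr; linarith
  have e1 : (j : ℝ) / (j + 1 : ℕ) = 1 + y := by push_cast; rw [hy]; field_simp; ring
  have e2 : |α * (1 / j + y)| ≤ α * (1 / j) ^ 2 := by
    have : 1 / (j : ℝ) + y = 1 / j * (1 / (j + 1)) := by rw [hy]; field_simp; ring
    rw [this, abs_of_pos (by positivity), pow_two]
    gcongr; linarith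
  have e3 := h y hy2
  have e4 : y ^ 2 ≤ (1 / (j : ℝ)) ^ 2 := by
    rw [← sq_abs y]; gcongr
  have e5 : d * (1 - (1 + y) ^ α) + g =
      (g + α * (d / j)) - d * (((1 + y) ^ α - 1 - α * y) + α * (1 / j + y)) := by ring
  rw [e1, e5]
  refine (abs_sub _ _).trans ?_
  gcongr
  rw [abs_mul]
  calc |d| * |((1 + y) ^ α - 1 - α * y) + α * (1 / j + y)|
      ≤ j * ((C + α) * (1 / j) ^ 2) := by
        gcongr
        refine (abs_add_le _ _).trans ?_
        have : C * y ^ 2 ≤ C * (1 / (j : ℝ)) ^ 2 := by gcongr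
        linarith
    _ = _ := by field_simp

namespace Urn

variable {Ω : Type*} [mΩ : MeasurableSpace Ω] {μ : Measure Ω} {b r : ℕ → ℝ}

lemma Bl_add_Re (U : Urn μ b r) (n : ℕ) (ω : Ω) : U.Bl n ω + U.Re n ω = n := by
  induction n with
  | zero => simp [U.init_Bl, U.init_Re]
  | succ n ih => rcases U.step n ω with h | h <;> omega

lemma D_eq (U : Urn μ b r) (n : ℕ) (ω : Ω) : (U.D n ω : ℝ) = (U.Re n ω : ℝ) - U.Bl n ω := by
  simp [D]

lemma abs_D_le (U : Urn μ b r) (n : ℕ) (ω : Ω) : |(U.D n ω : ℝ)| ≤ n := by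
  have h : ((U.Bl n ω : ℝ)) + U.Re n ω = n := by exact_mod_cast U.Bl_add_Re n ω
  have h1 : (0 : ℝ) ≤ U.Bl n ω := Nat.cast_nonneg _
  have h2 : (0 : ℝ) ≤ U.Re n ω := Nat.cast_nonneg _
  rw [D_eq, abs_le]; constructor <;> linarith

lemma D_succ_sub (U : Urn μ b r) (n : ℕ) (ω : Ω) :
    (U.D (n + 1) ω : ℝ) - U.D n ω = 1 - 2 * (if U.Bl (n + 1) ω = U.Bl n ω + 1 then (1 : ℝ) else 0) := by
  rw [D_eq, D_eq]
  rcases U.step n ω with h | h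
  · rw [if_pos h.1, h.1, h.2]; push_cast; ring
  · rw [if_neg (by omega), h.1, h.2]; push_cast; ring

lemma D_succ_sub_sq (U : Urn μ b r) (n : ℕ) (ω : Ω) :
    ((U.D (n + 1) ω : ℝ) - U.D n ω) ^ 2 = 1 := by
  rw [D_succ_sub]; split_ifs <;> norm_num

lemma F_le (U : Urn μ b r) (n : ℕ) : U.F n ≤ mΩ :=
  iSup₂_le fun j _ => ((U.meas_Bl j).prodMk (U.meas_Re j)).comap_le

lemma F_mono (U : Urn μ b r) {n n' : ℕ} (h : n ≤ n') : U.F n ≤ U.F n' :=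
  iSup₂_le fun j hj =>
    le_iSup₂_of_le (f := fun j (_ : j ∈ Set.Iic n') =>
      MeasurableSpace.comap (fun ω => (U.Bl j ω, U.Re j ω)) inferInstance)
      j (le_trans (Set.mem_Iic.1 hj) h) le_rfl

lemma measurable_F (U : Urn μ b r) (n : ℕ) (f : ℕ × ℕ → ℝ) :
    Measurable[U.F n] fun ω => f (U.Bl n ω, U.Re n ω) := by
  have h : Measurable[U.F n] fun ω => (U.Bl n ω, U.Re n ω) :=
    measurable_iff_comap_le.2 (le_iSup₂_of_le (f := fun j (_ : j ∈ Set.Iic n) =>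
      MeasurableSpace.comap (fun ω => (U.Bl j ω, U.Re j ω)) inferInstance) n
      (Set.mem_Iic.2 le_rfl) le_rfl)
  exact (measurable_of_countable f).comp h

/-- The conditional expectation of the `n`-th increment of the discrepancy. -/
noncomputable def G (U : Urn μ b r) (n : ℕ) (ω : Ω) : ℝ := drift b r (U.Bl n ω) (U.Re n ω)

lemma boundedMeasurable_D (U : Urn μ b r) (n : ℕ) :
    BoundedMeasurable (U.F n) (fun ω => (U.D n ω : ℝ)) :=
  ⟨by simpa only [D_eq] using U.measurable_F n (fun x => (x.2 : ℝ) - x.1), n, U.abs_D_le n⟩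

lemma boundedMeasurable_G (U : Urn μ b r) (hb : ∀ i, 0 < b i) (hr : ∀ i, 0 < r i) (n : ℕ) :
    BoundedMeasurable (U.F n) (U.G n) :=
  ⟨U.measurable_F n (fun x => drift b r x.1 x.2), 1, fun _ => abs_drift_le_one hb hr _ _⟩

/-- The martingale obtained by summing the compensated increments with weights `c`. -/
noncomputable def S (U : Urn μ b r) (c : ℕ → ℝ) (k m : ℕ) (ω : Ω) : ℝ :=
  ∑ j ∈ Finset.Ico k m, c j * ((U.D (j + 1) ω : ℝ) - U.D j ω - U.G j ω)

/-- The predictable part of the `j`-th increment of the rescaled discrepancy. -/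
noncomputable def X (U : Urn μ b r) (α : ℝ) (j : ℕ) (ω : Ω) : ℝ :=
  (U.D j ω : ℝ) * (1 - ((j : ℝ) / (j + 1 : ℕ)) ^ α) + U.G j ω

lemma boundedMeasurable_X (U : Urn μ b r) (hb : ∀ i, 0 < b i) (hr : ∀ i, 0 < r i) (α : ℝ)
    (j : ℕ) : BoundedMeasurable (U.F j) (U.X α j) :=
  ((U.boundedMeasurable_D j).mul (.const _)).add (U.boundedMeasurable_G hb hr j)

lemma rescaled_D_sub (U : Urn μ b r) (α : ℝ) {n : ℝ} (hn : 0 < n) {k m : ℕ} (hkm : k ≤ m) (ω : Ω) :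
    (U.D m ω : ℝ) * ((m : ℝ) / n) ^ α - (U.D k ω : ℝ) * ((k : ℝ) / n) ^ α
      = U.S (fun j => (((j + 1 : ℕ) : ℝ) / n) ^ α) k m ω
        + ∑ j ∈ Finset.Ico k m, (((j + 1 : ℕ) : ℝ) / n) ^ α * U.X α j ω := by
  induction m, hkm using Nat.le_induction with
  | base => simp [S]
  | succ m hkm ih =>
    rw [S, Finset.sum_Ico_succ_top hkm, Finset.sum_Ico_succ_top hkm, ← S]
    have e : ((m : ℝ) / n) ^ α = (((m + 1 : ℕ) : ℝ) / n) ^ α * ((m : ℝ) / (m + 1 : ℕ)) ^ α := by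
      rw [← Real.mul_rpow (by positivity) (by positivity)]
      congr 1
      have : ((m + 1 : ℕ) : ℝ) ≠ 0 := by positivity
      field_simp
    rw [e] at ih
    rw [X]
    linear_combination ih

lemma boundedMeasurable_S (U : Urn μ b r) (hb : ∀ i, 0 < b i) (hr : ∀ i, 0 < r i) (c : ℕ → ℝ)
    (k m : ℕ) : BoundedMeasurable (U.F m) (U.S c k m) := by
  refine BoundedMeasurable.sum fun j hj => ?_
  have hj := (Finset.mem_Ico.1 hj).2
  exact ((((U.boundedMeasurable_D (j + 1)).mono (U.F_mono hj)).sub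
    ((U.boundedMeasurable_D j).mono (U.F_mono hj.le))).sub
    ((U.boundedMeasurable_G hb hr j).mono (U.F_mono hj.le))).const_mul _

variable [IsProbabilityMeasure μ]

lemma integral_mul_D_succ_sub (U : Urn μ b r) (hb : ∀ i, 0 < b i) (hr : ∀ i, 0 < r i) {n : ℕ}
    {h : Ω → ℝ} (hh : BoundedMeasurable (U.F n) h) :
    ∫ ω, h ω * ((U.D (n + 1) ω : ℝ) - U.D n ω) ∂μ = ∫ ω, h ω * U.G n ω ∂μ := by
  set I : Ω → ℝ := fun ω => if U.Bl (n + 1) ω = U.Bl n ω + 1 then (1 : ℝ) else 0 with hI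
  have hs : BoundedMeasurable mΩ fun ω => (U.D (n + 1) ω : ℝ) - U.D n ω :=
    ((U.boundedMeasurable_D (n + 1)).mono (U.F_le _)).sub
      ((U.boundedMeasurable_D n).mono (U.F_le _))
  have hIe : I = fun ω => (1 / 2) * (1 - ((U.D (n + 1) ω : ℝ) - U.D n ω)) := by
    ext ω; rw [D_succ_sub]; ring
  have hIb : BoundedMeasurable mΩ I := by
    rw [hIe]; exact ((BoundedMeasurable.const 1).sub hs).const_mul _
  have hh' := hh.mono (U.F_le n)
  have hG' := (U.boundedMeasurable_G hb hr n).mono (U.F_le n)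
  have key : ∫ ω, h ω * I ω ∂μ = ∫ ω, h ω * (b (U.Bl n ω) / (b (U.Bl n ω) + r (U.Re n ω))) ∂μ := by
    rw [← integral_condExp (U.F_le n)]
    refine integral_congr_ae ?_
    have h1 := condExp_mul_of_stronglyMeasurable_left (μ := μ) (m := U.F n) (g := I)
      hh.1.stronglyMeasurable (hh'.mul hIb).integrable hIb.integrable
    have h2 : μ[I | U.F n] =ᵐ[μ] fun ω => b (U.Bl n ω) / (b (U.Bl n ω) + r (U.Re n ω)) := U.markov n
    refine h1.trans ?_
    filter_upwards [h2] with ω hω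
    rw [Pi.mul_apply, hω]
  have e1 : ∀ ω, h ω * ((U.D (n + 1) ω : ℝ) - U.D n ω) = h ω - 2 * (h ω * I ω) := fun ω => by
    rw [D_succ_sub]; ring
  have e2 : ∀ ω, h ω * (b (U.Bl n ω) / (b (U.Bl n ω) + r (U.Re n ω)))
      = (1 / 2) * (h ω - h ω * U.G n ω) := fun ω => by
    rw [G, drift]; ring
  simp only [e2] at key
  simp only [e1]
  rw [integral_sub hh'.integrable ((hh'.mul hIb).const_mul 2).integrable, integral_const_mul, key,
    integral_const_mul, integral_sub hh'.integrable (hh'.mul hG').integrable]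
  ring

lemma integral_add_mul_D_succ_sub (U : Urn μ b r) (hb : ∀ i, 0 < b i) (hr : ∀ i, 0 < r i) {n : ℕ}
    {f h : Ω → ℝ} (hf : BoundedMeasurable (U.F n) f) (hh : BoundedMeasurable (U.F n) h) :
    ∫ ω, (f ω + h ω * ((U.D (n + 1) ω : ℝ) - U.D n ω)) ∂μ = ∫ ω, (f ω + h ω * U.G n ω) ∂μ := by
  have hs : BoundedMeasurable mΩ fun ω => (U.D (n + 1) ω : ℝ) - U.D n ω :=
    ((U.boundedMeasurable_D (n + 1)).mono (U.F_le _)).sub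
      ((U.boundedMeasurable_D n).mono (U.F_le _))
  have hh' := hh.mono (U.F_le n)
  have hf' := hf.mono (U.F_le n)
  have hG' := (U.boundedMeasurable_G hb hr n).mono (U.F_le n)
  rw [integral_add hf'.integrable (hh'.mul hs).integrable, U.integral_mul_D_succ_sub hb hr hh,
    integral_add hf'.integrable (hh'.mul hG').integrable]

lemma integral_D_sq_le (U : Urn μ b r) (hb : ∀ i, 0 < b i) (hr : ∀ i, 0 < r i) {C : ℝ}
    (hC : ∀ i j : ℕ, ((j : ℝ) - i) * drift b r i j ≤ C) (n : ℕ) :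
    ∫ ω, (U.D n ω : ℝ) ^ 2 ∂μ ≤ (2 * C + 1) * n := by
  induction n with
  | zero => simp [D, U.init_Bl, U.init_Re]
  | succ n ih =>
    have hD := U.boundedMeasurable_D n
    have hG := U.boundedMeasurable_G hb hr n
    have e : ∀ ω, (U.D (n + 1) ω : ℝ) ^ 2 = ((U.D n ω : ℝ) ^ 2 + 1)
        + 2 * (U.D n ω : ℝ) * ((U.D (n + 1) ω : ℝ) - U.D n ω) := fun ω => by
      linear_combination U.D_succ_sub_sq n ω
    have hf := (hD.pow 2).add (.const 1)
    have hh := hD.const_mul 2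
    simp only [e]
    rw [U.integral_add_mul_D_succ_sub hb hr hf hh]
    calc _ ≤ ∫ ω, ((U.D n ω : ℝ) ^ 2 + (2 * C + 1)) ∂μ := by
          refine integral_mono ((hf.add (hh.mul hG)).mono (U.F_le n)).integrable
            (((hD.pow 2).add (.const _)).mono (U.F_le n)).integrable fun ω => ?_
          have := hC (U.Bl n ω) (U.Re n ω)
          rw [← D_eq] at this
          simp only [G]
          linarith
      _ = ∫ ω, (U.D n ω : ℝ) ^ 2 ∂μ + (2 * C + 1) := by
          rw [integral_add ((hD.pow 2).mono (U.F_le n)).integrable (integrable_const _)]; simp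
      _ ≤ _ := by push_cast; linarith

lemma integral_D_pow_four_le (U : Urn μ b r) (hb : ∀ i, 0 < b i) (hr : ∀ i, 0 < r i) {C : ℝ}
    (hC0 : 0 < C) (hC : ∀ i j : ℕ, ((j : ℝ) - i) * drift b r i j ≤ C) (n : ℕ) :
    ∫ ω, (U.D n ω : ℝ) ^ 4 ∂μ ≤ (6 + 4 * C) * (2 * C + 1) * n ^ 2 := by
  induction n with
  | zero => simp [D, U.init_Bl, U.init_Re]
  | succ n ih =>
    have hD := U.boundedMeasurable_D n
    have hG := U.boundedMeasurable_G hb hr n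
    have e : ∀ ω, (U.D (n + 1) ω : ℝ) ^ 4 = ((U.D n ω : ℝ) ^ 4 + (6 * (U.D n ω : ℝ) ^ 2 + 1))
        + (4 * (U.D n ω : ℝ) ^ 3 + 4 * (U.D n ω : ℝ)) * ((U.D (n + 1) ω : ℝ) - U.D n ω) :=
      fun ω => by
        linear_combination (6 * (U.D n ω : ℝ) ^ 2 + 4 * (U.D n ω : ℝ) *
          ((U.D (n + 1) ω : ℝ) - U.D n ω) + ((U.D (n + 1) ω : ℝ) - U.D n ω) ^ 2 + 1)
          * U.D_succ_sub_sq n ω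
    have hf := (hD.pow 4).add (((hD.pow 2).const_mul 6).add (.const 1))
    have hh := ((hD.pow 3).const_mul 4).add (hD.const_mul 4)
    have hk := ((hD.pow 2).const_mul (6 + 4 * C)).add (.const (1 + 4 * C))
    simp only [e]
    rw [U.integral_add_mul_D_succ_sub hb hr hf hh]
    calc _ ≤ ∫ ω, ((U.D n ω : ℝ) ^ 4 + ((6 + 4 * C) * (U.D n ω : ℝ) ^ 2 + (1 + 4 * C))) ∂μ := by
          refine integral_mono ((hf.add (hh.mul hG)).mono (U.F_le n)).integrable
            (((hD.pow 4).add hk).mono (U.F_le n)).integrable fun ω => ?_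
          have := hC (U.Bl n ω) (U.Re n ω)
          rw [← D_eq] at this
          simp only [G]
          nlinarith [sq_nonneg (U.D n ω : ℝ)]
      _ = ∫ ω, (U.D n ω : ℝ) ^ 4 ∂μ + ((6 + 4 * C) * ∫ ω, (U.D n ω : ℝ) ^ 2 ∂μ + (1 + 4 * C)) := by
          rw [integral_add ((hD.pow 4).mono (U.F_le n)).integrable (hk.mono (U.F_le n)).integrable,
            integral_add (((hD.pow 2).const_mul _).mono (U.F_le n)).integrable
              (integrable_const _), integral_const_mul]
          simp
      _ ≤ _ := by
          have h2 := mul_le_mul_of_nonneg_left (U.integral_D_sq_le hb hr hC n)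
            (by positivity : 0 ≤ 6 + 4 * C)
          have hn : (0 : ℝ) ≤ n := n.cast_nonneg
          have h3 : 0 ≤ (6 + 4 * C) * (2 * C + 1) * n := by positivity
          push_cast
          nlinarith [sq_nonneg C]

lemma integral_S (U : Urn μ b r) (hb : ∀ i, 0 < b i) (hr : ∀ i, 0 < r i) (c : ℕ → ℝ)
    {k m : ℕ} (hkm : k ≤ m) : ∫ ω, U.S c k m ω ∂μ = 0 := by
  induction m, hkm using Nat.le_induction with
  | base => simp [S]
  | succ m hkm ih =>
    have hS := U.boundedMeasurable_S hb hr c k m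
    have hG := U.boundedMeasurable_G hb hr m
    have e : ∀ ω, U.S c k (m + 1) ω = (U.S c k m ω - c m * U.G m ω)
        + c m * ((U.D (m + 1) ω : ℝ) - U.D m ω) := fun ω => by
      rw [S, Finset.sum_Ico_succ_top hkm, ← S]; ring
    simp only [e]
    rw [U.integral_add_mul_D_succ_sub hb hr (hS.sub (hG.const_mul (c m))) (.const (c m)), ← ih]
    congr 1; ext ω; ring

lemma integral_S_sq (U : Urn μ b r) (hb : ∀ i, 0 < b i) (hr : ∀ i, 0 < r i) (c : ℕ → ℝ)
    {k m : ℕ} (hkm : k ≤ m) : ∫ ω, U.S c k m ω ^ 2 ∂μ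
      = ∑ j ∈ Finset.Ico k m, c j ^ 2 * (1 - ∫ ω, U.G j ω ^ 2 ∂μ) := by
  induction m, hkm using Nat.le_induction with
  | base => simp [S]
  | succ m hkm ih =>
    have hS := U.boundedMeasurable_S hb hr c k m
    have hG := U.boundedMeasurable_G hb hr m
    have e : ∀ ω, U.S c k (m + 1) ω ^ 2
        = ((U.S c k m ω - c m * U.G m ω) ^ 2 + c m ^ 2)
        + 2 * c m * (U.S c k m ω - c m * U.G m ω) * ((U.D (m + 1) ω : ℝ) - U.D m ω) := fun ω => by
      rw [S, Finset.sum_Ico_succ_top hkm, ← S]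
      linear_combination c m ^ 2 * U.D_succ_sub_sq m ω
    have hX := hS.sub (hG.const_mul (c m))
    simp only [e]
    rw [U.integral_add_mul_D_succ_sub hb hr ((hX.pow 2).add (.const _))
      (hX.const_mul (2 * c m)), Finset.sum_Ico_succ_top hkm, ← ih]
    have e2 : ∀ ω, (U.S c k m ω - c m * U.G m ω) ^ 2 + c m ^ 2
        + 2 * c m * (U.S c k m ω - c m * U.G m ω) * U.G m ω
        = U.S c k m ω ^ 2 + (c m ^ 2 - c m ^ 2 * U.G m ω ^ 2) := fun ω => by ring
    have hG2 := (hG.pow 2).const_mul (c m ^ 2)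
    have hcG := (BoundedMeasurable.const (c m ^ 2)).sub hG2
    simp only [e2]
    rw [integral_add ((hS.pow 2).mono (U.F_le m)).integrable (hcG.mono (U.F_le m)).integrable,
      integral_sub (integrable_const _) (hG2.mono (U.F_le m)).integrable, integral_const_mul]
    simp only [integral_const, probReal_univ, one_smul]
    ring

lemma exists_integral_sq_le {w : ℕ → ℝ} {α B : ℝ} (hα : 0 < α) (hw : ∀ n, 0 < w n)
    (hasymp : WeightAsymp w α B) (hchoice : UrnChoice w b r) (U : Urn μ b r)
    (hb : ∀ i, 0 < b i) (hr : ∀ i, 0 < r i) :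
    ∃ A > 0, ∀ j : ℕ, 0 < j → ∫ ω, U.G j ω ^ 2 ∂μ ≤ A / j ∧
      ∫ ω, U.X α j ω ^ 2 ∂μ ≤ A / (j : ℝ) ^ 2 := by
  obtain ⟨C, hC, hdrift, hC'⟩ := exists_drift_bounds hα hw hasymp hchoice
  obtain ⟨C', hC'pos, hX⟩ := exists_abs_mul_one_sub_rpow_add_le α hα
  set E : ℝ := C + C' with hE
  set M : ℝ := (6 + 4 * C) * (2 * C + 1) with hM
  have hE0 : 0 < E := by positivity
  have hM0 : 0 < M := by positivity
  have happrox : ∀ j : ℕ, 0 < j → ∀ ω, |U.G j ω + α * ((U.D j ω : ℝ) / j)|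
      ≤ C * (1 / (j : ℝ) + ((U.D j ω : ℝ) / j) ^ 2) := by
    intro j hj ω
    have hs := U.Bl_add_Re j ω
    have := hdrift (U.Bl j ω) (U.Re j ω) (by omega)
    rwa [← Nat.cast_add, hs, ← D_eq] at this
  have hXb : ∀ j : ℕ, 0 < j → ∀ ω,
      U.X α j ω ^ 2 ≤ 2 * E ^ 2 * (1 / (j : ℝ)) ^ 2 + 2 * E ^ 2 / (j : ℝ) ^ 4 * (U.D j ω : ℝ) ^ 4 := by
    intro j hj ω
    have hj0 : (0 : ℝ) < j := by exact_mod_cast hj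
    have h1 : |U.X α j ω| ≤ E * (1 / (j : ℝ) + ((U.D j ω : ℝ) / j) ^ 2) := by
      refine (hX j hj _ _ (U.abs_D_le j ω)).trans ?_
      have h2 := happrox j hj ω
      have : 0 ≤ C' * ((U.D j ω : ℝ) / j) ^ 2 := by positivity
      rw [hE]
      linarith
    have h3 : U.X α j ω ^ 2 ≤ (E * (1 / (j : ℝ) + ((U.D j ω : ℝ) / j) ^ 2)) ^ 2 := by
      rw [← sq_abs]; gcongr
    have h4 : 2 * E ^ 2 * (1 / (j : ℝ)) ^ 2 + 2 * E ^ 2 / (j : ℝ) ^ 4 * (U.D j ω : ℝ) ^ 4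
        - (E * (1 / (j : ℝ) + ((U.D j ω : ℝ) / j) ^ 2)) ^ 2
        = E ^ 2 * (1 / (j : ℝ) - ((U.D j ω : ℝ) / j) ^ 2) ^ 2 := by ring
    have h5 : 0 ≤ E ^ 2 * (1 / (j : ℝ) - ((U.D j ω : ℝ) / j) ^ 2) ^ 2 := by positivity
    linarith
  have hGb : ∀ j : ℕ, 0 < j → ∀ ω,
      U.G j ω ^ 2 ≤ 2 * C ^ 2 / j + 2 * (α + C) ^ 2 / (j : ℝ) ^ 2 * (U.D j ω : ℝ) ^ 2 := by
    intro j hj ω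
    have hj1 : (1 : ℝ) ≤ j := by exact_mod_cast hj
    have hj0 : (0 : ℝ) < j := by linarith
    set y : ℝ := (U.D j ω : ℝ) / j with hy
    have hy1 : |y| ≤ 1 := by
      rw [hy, abs_div, abs_of_pos hj0, div_le_one hj0]; exact U.abs_D_le j ω
    have h1 : |U.G j ω| ≤ C * (1 / j) + (α + C) * |y| := by
      have e : U.G j ω = (U.G j ω + α * y) - α * y := by ring
      rw [e]
      refine (abs_sub _ _).trans ?_
      have h2 := happrox j hj ω
      rw [abs_mul α, abs_of_pos hα]
      have h3 : C * y ^ 2 ≤ C * |y| := by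
        rw [← sq_abs]; gcongr; nlinarith [abs_nonneg y]
      linarith
    have h2 : U.G j ω ^ 2 ≤ (C * (1 / j) + (α + C) * |y|) ^ 2 := by
      rw [← sq_abs]; gcongr
    have h3 : (C * (1 / (j : ℝ))) ^ 2 ≤ C ^ 2 / j := by
      rw [mul_pow, div_eq_mul_one_div (C ^ 2)]
      have : 1 / (j : ℝ) ≤ 1 := by rw [div_le_one hj0]; exact hj1
      have h0 : 0 < 1 / (j : ℝ) := by positivity
      gcongr; nlinarith
    have h4 : ((α + C) * |y|) ^ 2 = (α + C) ^ 2 / (j : ℝ) ^ 2 * (U.D j ω : ℝ) ^ 2 := by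
      rw [mul_pow, sq_abs, hy]; ring
    have h5 := sq_nonneg (C * (1 / (j : ℝ)) - (α + C) * |y|)
    have h6 : 2 * C ^ 2 / j = 2 * (C ^ 2 / (j : ℝ)) := by ring
    have h7 : 2 * (α + C) ^ 2 / (j : ℝ) ^ 2 * (U.D j ω : ℝ) ^ 2
      = 2 * ((α + C) ^ 2 / (j : ℝ) ^ 2 * (U.D j ω : ℝ) ^ 2) := by ring
    rw [h6, h7, ← h4]
    nlinarith
  refine ⟨(2 * C ^ 2 + 2 * (α + C) ^ 2 * (2 * C + 1)) + (2 * E ^ 2 + 2 * E ^ 2 * M),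
    by positivity, fun j hj => ?_⟩
  have hj0 : (0 : ℝ) < j := by exact_mod_cast hj
  have hD := (U.boundedMeasurable_D j).mono (U.F_le j)
  have hII : ∀ (f : Ω → ℝ) (a q : ℝ) (p : ℕ), BoundedMeasurable mΩ f →
      (∀ ω, f ω ^ 2 ≤ a + q * (U.D j ω : ℝ) ^ p) →
      ∫ ω, f ω ^ 2 ∂μ ≤ a + q * ∫ ω, (U.D j ω : ℝ) ^ p ∂μ := by
    intro f a q p hf h
    have hp := (hD.pow p).const_mul q
    refine (integral_mono (hf.pow 2).integrable ((BoundedMeasurable.const a).add hp).integrable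
      h).trans_eq ?_
    rw [integral_add (integrable_const _) hp.integrable, integral_const_mul]
    simp
  constructor
  · refine (hII _ _ _ _ ((U.boundedMeasurable_G hb hr j).mono (U.F_le j)) (hGb j hj)).trans ?_
    calc _ ≤ 2 * C ^ 2 / j + 2 * (α + C) ^ 2 / (j : ℝ) ^ 2 * ((2 * C + 1) * j) := by
          gcongr; exact U.integral_D_sq_le hb hr hC' j
      _ = (2 * C ^ 2 + 2 * (α + C) ^ 2 * (2 * C + 1)) / j := by field_simp
      _ ≤ _ := div_le_div_of_nonneg_right
          (by linarith [show 0 < 2 * E ^ 2 + 2 * E ^ 2 * M by positivity]) hj0.le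
  · refine (hII _ _ _ _ ((U.boundedMeasurable_X hb hr α j).mono (U.F_le j)) (hXb j hj)).trans ?_
    calc _ ≤ 2 * E ^ 2 * (1 / (j : ℝ)) ^ 2 + 2 * E ^ 2 / (j : ℝ) ^ 4 * (M * (j : ℝ) ^ 2) := by
          gcongr; exact U.integral_D_pow_four_le hb hr hC hC' j
      _ = (2 * E ^ 2 + 2 * E ^ 2 * M) / (j : ℝ) ^ 2 := by field_simp
      _ ≤ _ := div_le_div_of_nonneg_right
          (by linarith [show 0 < 2 * C ^ 2 + 2 * (α + C) ^ 2 * (2 * C + 1) by positivity])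
          (by positivity)

end Urn

theorem variance_rescaled_discrepancy_diff {Ω : Type*} [MeasurableSpace Ω] (μ : MeasureTheory.Measure Ω) [MeasureTheory.IsProbabilityMeasure μ]
    (α B : ℝ) (hα : 0 < α) (w : ℕ → ℝ) (hw : ∀ n, 0 < w n)
    (hasymp : WeightAsymp w α B)
    (b r : ℕ → ℝ) (hb : ∀ i, 0 < b i) (hr : ∀ i, 0 < r i)
    (hchoice : UrnChoice w b r) (U : Urn μ b r) :
    ∀ δ : ℝ, 0 < δ → δ < 2 → ∃ C₂ > (0:ℝ), ∃ N : ℕ, ∀ n : ℕ, N ≤ n →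
      ∀ k m : ℕ, δ * (n:ℝ) ≤ (k:ℝ) → k ≤ m → m ≤ 2*n →
        |variance (fun ω => (U.D m ω : ℝ) * ((m:ℝ)/(n:ℝ)) ^ α
            - (U.D k ω : ℝ) * ((k:ℝ)/(n:ℝ)) ^ α) μ
          - (n:ℝ) * ∫ u in ((k:ℝ)/(n:ℝ))..((m:ℝ)/(n:ℝ)), u ^ (2*α)|
        ≤ C₂ * Real.sqrt n * (Real.log n)^2 := by
  intro δ hδ _
  obtain ⟨A, hA, hAb⟩ := U.exists_integral_sq_le hα hw hasymp hchoice hb hr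
  set T : ℝ := (2 : ℝ) ^ (2 * α) with hT
  have hT0 : 0 < T := by positivity
  refine ⟨3 * T + 2 * T * A / δ + 8 * T * A / δ ^ 2, by positivity, 3, fun n hn k m hk hkm hm => ?_⟩
  have hn3 : (3 : ℝ) ≤ n := by exact_mod_cast hn
  have hn0 : (0 : ℝ) < n := by linarith
  have hm2 : (m : ℝ) ≤ 2 * n := by exact_mod_cast hm
  have hk0 : 0 < k := by
    have : (0 : ℝ) < k := lt_of_lt_of_le (by positivity) hk
    exact_mod_cast this
  set c : ℕ → ℝ := fun j => (((j + 1 : ℕ) : ℝ) / n) ^ α with hc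
  have hc2 : ∀ j, c j ^ 2 = (((j + 1 : ℕ) : ℝ) / n) ^ (2 * α) := fun j => by
    rw [hc, mul_comm 2 α]
    exact_mod_cast (Real.rpow_mul_natCast (by positivity) α 2).symm
  have hle : ∀ j : ℕ, j ≤ m → ((j : ℝ) / n) ^ (2 * α) ≤ T := fun j hj => by
    refine Real.rpow_le_rpow (by positivity) ?_ (by positivity)
    rw [div_le_iff₀ hn0]
    exact (Nat.cast_le.2 hj).trans hm2
  have hcT : ∀ j ∈ Finset.Ico k m, c j ^ 2 ≤ T := fun j hj => by
    rw [hc2]; exact hle _ (Finset.mem_Ico.1 hj).2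
  have hcard : ((Finset.Ico k m).card : ℝ) ≤ 2 * n := by
    rw [Nat.card_Ico]
    exact (Nat.cast_le.2 (Nat.sub_le m k)).trans hm2
  have hsum : ∀ (f : ℕ → ℝ) (a : ℝ), 0 ≤ a → (∀ j ∈ Finset.Ico k m, f j ≤ a) →
      ∑ j ∈ Finset.Ico k m, f j ≤ 2 * n * a := fun f a ha h => by
    refine (Finset.sum_le_card_nsmul _ _ _ h).trans ?_
    rw [nsmul_eq_mul]; gcongr
  set R : Ω → ℝ := fun ω => ∑ j ∈ Finset.Ico k m, c j * U.X α j ω with hR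
  have hSb := (U.boundedMeasurable_S hb hr c k m).mono (U.F_le m)
  have hXb : ∀ j, BoundedMeasurable _ (U.X α j) :=
    fun j => (U.boundedMeasurable_X hb hr α j).mono (U.F_le j)
  have hRb : BoundedMeasurable _ R := BoundedMeasurable.sum fun j _ => (hXb j).const_mul (c j)
  have hjδ : ∀ j ∈ Finset.Ico k m, 0 < j ∧ δ * n ≤ j := fun j hj => by
    have := (Finset.mem_Ico.1 hj).1
    exact ⟨by omega, hk.trans (Nat.cast_le.2 this)⟩
  have hRint : ∫ ω, R ω ^ 2 ∂μ ≤ 4 * T * A / δ ^ 2 := by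
    have h1 : ∀ ω, R ω ^ 2 ≤ 2 * n * ∑ j ∈ Finset.Ico k m, c j ^ 2 * U.X α j ω ^ 2 := fun ω => by
      refine sq_sum_le_card_mul_sum_sq.trans ?_
      simp only [mul_pow]
      gcongr
    have h2 : BoundedMeasurable _ fun ω => ∑ j ∈ Finset.Ico k m, c j ^ 2 * U.X α j ω ^ 2 :=
      BoundedMeasurable.sum fun j _ => ((hXb j).pow 2).const_mul (c j ^ 2)
    refine (integral_mono (hRb.pow 2).integrable (h2.const_mul (2 * (n : ℝ))).integrable h1).trans ?_
    rw [integral_const_mul, integral_finsetSum _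
      fun j _ => (((hXb j).pow 2).const_mul (c j ^ 2)).integrable]
    have h3 := hsum (fun j => ∫ ω, c j ^ 2 * U.X α j ω ^ 2 ∂μ) (T * (A / (δ * n) ^ 2))
      (by positivity) fun j hj => by
        rw [integral_const_mul]
        obtain ⟨hj0, hj⟩ := hjδ j hj
        refine mul_le_mul (hcT j ‹_›) (((hAb j hj0).2).trans ?_)
          (integral_nonneg fun ω => sq_nonneg _) hT0.le
        gcongr
    calc _ ≤ 2 * (n : ℝ) * (2 * n * (T * (A / (δ * n) ^ 2))) := by gcongr
      _ = _ := by field_simp; ring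
  have hGint : ∑ j ∈ Finset.Ico k m, c j ^ 2 * ∫ ω, U.G j ω ^ 2 ∂μ ≤ 2 * T * A / δ := by
    refine (hsum _ (T * (A / (δ * n))) (by positivity) fun j hj => ?_).trans_eq
      (by field_simp)
    obtain ⟨hj0, hj⟩ := hjδ j hj
    refine mul_le_mul (hcT j ‹_›) (((hAb j hj0).1).trans ?_)
      (integral_nonneg fun ω => sq_nonneg _) hT0.le
    gcongr
  have hGint0 : 0 ≤ ∑ j ∈ Finset.Ico k m, c j ^ 2 * ∫ ω, U.G j ω ^ 2 ∂μ :=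
    Finset.sum_nonneg fun j _ => mul_nonneg (sq_nonneg _) (integral_nonneg fun ω => sq_nonneg _)
  have hS2 : ∫ ω, U.S c k m ω ^ 2 ∂μ = ∑ j ∈ Finset.Ico k m, c j ^ 2
      - ∑ j ∈ Finset.Ico k m, c j ^ 2 * ∫ ω, U.G j ω ^ 2 ∂μ := by
    rw [U.integral_S_sq hb hr c hkm, ← Finset.sum_sub_distrib]
    exact Finset.sum_congr rfl fun j _ => by ring
  have hcsum : ∑ j ∈ Finset.Ico k m, c j ^ 2 ≤ 2 * n * T := hsum _ T hT0.le hcT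
  have hRiem := abs_sum_rpow_sub_integral_le (β := 2 * α) (by positivity) hn0 hkm
  simp only [← hc2] at hRiem
  have hRiem' := abs_le.1 (hRiem.trans (hle m le_rfl))
  set q : ℝ := Real.sqrt n with hq
  have hq1 : 1 ≤ q := Real.one_le_sqrt.2 (by linarith)
  have hqn : q ^ 2 = n := Real.sq_sqrt hn0.le
  have hvar := abs_variance_add_sub_le hSb hRb (U.integral_S hb hr c hkm) (t := q) (by linarith)
  have hSq : (∫ ω, U.S c k m ω ^ 2 ∂μ) / q ≤ 2 * T * q := by
    rw [div_le_iff₀ (by linarith)]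
    nlinarith
  have hRq : (q + 1) * ∫ ω, R ω ^ 2 ∂μ ≤ 8 * T * A / δ ^ 2 * q := by
    have h0 : 0 ≤ 4 * T * A / δ ^ 2 := by positivity
    calc (q + 1) * ∫ ω, R ω ^ 2 ∂μ ≤ (q + q) * (4 * T * A / δ ^ 2) := by
          gcongr
      _ = _ := by ring
  have hlog : 1 ≤ Real.log n := by
    rw [Real.le_log_iff_exp_le hn0]
    linarith [Real.exp_one_lt_d9]
  simp only [U.rescaled_D_sub α hn0 hkm]
  set I : ℝ := (n : ℝ) * ∫ u in ((k:ℝ)/(n:ℝ))..((m:ℝ)/(n:ℝ)), u ^ (2*α)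
  set V : ℝ := variance (fun ω => U.S c k m ω + R ω) μ
  have hfin : |V - I| ≤ (3 * T + 2 * T * A / δ + 8 * T * A / δ ^ 2) * q := by
    have h1 : T ≤ T * q := le_mul_of_one_le_right hT0.le hq1
    have h2 : 2 * T * A / δ ≤ 2 * T * A / δ * q := le_mul_of_one_le_right (by positivity) hq1
    have h3 := abs_le.1 hvar
    rw [abs_le]; constructor <;> linarith
  exact hfin.trans (le_mul_of_one_le_right (by positivity) (one_le_pow₀ hlog))
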